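/- Let α be a simple affine root and let σ, τ be involutions in the affine Weyl group with σ < τ in Bruhat order. If s_α ∘ σ > σ and s_α ∘ τ < τ, then s_α ∘ σ ≤ τ and σ ≤ s_α ∘ τ. -/

import Mathlib

open scoped Classical RealInnerProductSpace

/-- The pairing `⟨γ, α^∨⟩ = 2(γ,α)/(α,α)`. -/
noncomputable def pairing {V : Type*} [NormedAddCommGroup V] [InnerProductSpace ℝ V]
    (γ α : V) : ℝ :=
  2 * ⟪γ, α⟫ / ⟪α, α⟫

/-- A finite (crystallographic, reduced) root system in a Euclidean space. -/
structure IsRootSystem {V : Type*} [NormedAddCommGroup V] [InnerProductSpace ℝ V]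
    (Φ : Set V) : Prop where
  finite : Φ.Finite
  ne_zero : ∀ α ∈ Φ, α ≠ 0
  neg_mem : ∀ α ∈ Φ, -α ∈ Φ
  reflect_mem : ∀ α ∈ Φ, ∀ β ∈ Φ, β - pairing β α • α ∈ Φ
  crystal : ∀ α ∈ Φ, ∀ β ∈ Φ, ∃ n : ℤ, pairing β α = n
  reduced : ∀ α ∈ Φ, ∀ t : ℝ, t • α ∈ Φ → t = 1 ∨ t = -1

/-- Irreducibility of a root system: no nontrivial orthogonal decomposition. -/
def IsIrreducibleRS {V : Type*} [NormedAddCommGroup V] [InnerProductSpace ℝ V]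
    (Φ : Set V) : Prop :=
  ∀ Φ₁ Φ₂ : Set V, Φ = Φ₁ ∪ Φ₂ → (∀ α ∈ Φ₁, ∀ β ∈ Φ₂, ⟪α, β⟫ = 0) → Φ₁ = ∅ ∨ Φ₂ = ∅

/-- A set of roots is strongly orthogonal if for any two distinct elements neither the sum
nor the difference is a root. -/
def StronglyOrthogonal {V : Type*} [NormedAddCommGroup V] [InnerProductSpace ℝ V]
    (Φ : Set V) (S : Set V) : Prop :=
  ∀ α ∈ S, ∀ β ∈ S, α ≠ β → α + β ∉ Φ ∧ α - β ∉ Φ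

/-- A set of pairwise orthogonal vectors. -/
def OrthogonalSet {V : Type*} [NormedAddCommGroup V] [InnerProductSpace ℝ V]
    (S : Set V) : Prop :=
  ∀ α ∈ S, ∀ β ∈ S, α ≠ β → ⟪α, β⟫ = 0

/-- A base (set of simple roots) of a root system. -/
structure IsBase {V : Type*} [NormedAddCommGroup V] [InnerProductSpace ℝ V]
    (Φ : Set V) (Δ : Finset V) : Prop where
  subset : ↑Δ ⊆ Φ
  indep : LinearIndependent ℝ (fun b : Δ => (b : V))
  pos_or_neg : ∀ α ∈ Φ, (∃ c : V → ℕ, α = ∑ b ∈ Δ, (c b : ℝ) • b) ∨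
    (∃ c : V → ℕ, -α = ∑ b ∈ Δ, (c b : ℝ) • b)

/-- The positive roots with respect to a base. -/
def PosRoots {V : Type*} [NormedAddCommGroup V] [InnerProductSpace ℝ V]
    (Φ : Set V) (Δ : Finset V) : Set V :=
  {α | α ∈ Φ ∧ ∃ c : V → ℕ, α = ∑ b ∈ Δ, (c b : ℝ) • b}

/-- `θ` is the highest root of `Φ` with respect to the base `Δ`. -/
def IsHighestRoot {V : Type*} [NormedAddCommGroup V] [InnerProductSpace ℝ V]
    (Φ : Set V) (Δ : Finset V) (θ : V) : Prop :=
  θ ∈ Φ ∧ ∀ α ∈ Φ, ∃ c : V → ℕ, θ - α = ∑ b ∈ Δ, (c b : ℝ) • b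

/-- The coroot of the real affine root `(β, n) = β + nδ`, as a linear functional on the affine
root space `V × ℝδ` (it kills `δ`). -/
noncomputable def acoroot {V : Type*} [NormedAddCommGroup V] [InnerProductSpace ℝ V]
    (β : V) : (V × ℝ) →ₗ[ℝ] ℝ :=
  (2 / ⟪β, β⟫) • ((innerSL ℝ β).toLinearMap ∘ₗ LinearMap.fst ℝ V ℝ)

/-- The reflection of the affine Weyl group corresponding to the real affine root
`β + nδ`, acting linearly on the affine root space `V ⊕ ℝδ`. -/
noncomputable def sAff {V : Type*} [NormedAddCommGroup V] [InnerProductSpace ℝ V]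
    (β : V) (n : ℝ) : Module.End ℝ (V × ℝ) :=
  LinearMap.id - LinearMap.smulRight (acoroot β) ((β, n) : V × ℝ)

/-- The set of reflections of the affine Weyl group of `Φ`. -/
def AffRefls {V : Type*} [NormedAddCommGroup V] [InnerProductSpace ℝ V]
    (Φ : Set V) : Set (Module.End ℝ (V × ℝ)) :=
  {f | ∃ β ∈ Φ, ∃ n : ℤ, f = sAff β (n : ℝ)}

/-- The positive real affine roots `α + nδ` with `n > 0`, or `n = 0` and `α` positive. -/
def PosAffRoots {V : Type*} [NormedAddCommGroup V] [InnerProductSpace ℝ V]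
    (Φ : Set V) (Δ : Finset V) : Set (V × ℝ) :=
  {p | p.1 ∈ Φ ∧ (∃ n : ℤ, p.2 = (n : ℝ)) ∧
    (0 < p.2 ∨ (p.2 = 0 ∧ p.1 ∈ PosRoots Φ Δ))}

/-- Length of an element of the affine Weyl group: the number of positive real affine roots
sent to negative ones. -/
noncomputable def affLength {V : Type*} [NormedAddCommGroup V] [InnerProductSpace ℝ V]
    (Φ : Set V) (Δ : Finset V) (w : Module.End ℝ (V × ℝ)) : ℕ :=
  {p | p ∈ PosAffRoots Φ Δ ∧ -(w p) ∈ PosAffRoots Φ Δ}.ncard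

/-- Bruhat order on the affine Weyl group: `u ≤ w` iff `w` is obtained from `u` by a chain of
right multiplications by reflections, each increasing the length. -/
def bruhatLE {V : Type*} [NormedAddCommGroup V] [InnerProductSpace ℝ V]
    (Φ : Set V) (Δ : Finset V) (u w : Module.End ℝ (V × ℝ)) : Prop :=
  Relation.ReflTransGen
    (fun a b => (∃ t ∈ AffRefls Φ, b = a * t) ∧ affLength Φ Δ a < affLength Φ Δ b) u w

/-- Strict Bruhat order. -/
def bruhatLT {V : Type*} [NormedAddCommGroup V] [InnerProductSpace ℝ V]
    (Φ : Set V) (Δ : Finset V) (u w : Module.End ℝ (V × ℝ)) : Prop :=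
  bruhatLE Φ Δ u w ∧ u ≠ w

/-- The simple affine roots `Δ ∪ {δ - θ}`, as elements of `V × ℝδ`. -/
def SimpleAffRoots {V : Type*} [NormedAddCommGroup V] [InnerProductSpace ℝ V]
    (Δ : Finset V) (θ : V) : Set (V × ℝ) :=
  (fun b => ((b, (0 : ℝ)) : V × ℝ)) '' ↑Δ ∪ {((-θ, (1 : ℝ)) : V × ℝ)}

/-- The Richardson–Springer monoid operation `s ∘ σ` on involutions. -/
noncomputable def rsCirc {V : Type*} [NormedAddCommGroup V] [InnerProductSpace ℝ V]
    (s σ : Module.End ℝ (V × ℝ)) : Module.End ℝ (V × ℝ) :=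
  if s * σ = σ * s then s * σ else s * σ * s


namespace Aff

variable {V : Type*} [NormedAddCommGroup V] [InnerProductSpace ℝ V]

/-- real affine roots -/
def R (Φ : Set V) : Set (V × ℝ) := {p | p.1 ∈ Φ ∧ ∃ n : ℤ, p.2 = (n : ℝ)}

noncomputable def rf (p : V × ℝ) : Module.End ℝ (V × ℝ) := sAff p.1 p.2

noncomputable def cc (p v : V × ℝ) : ℝ := 2 * ⟪p.1, v.1⟫ / ⟪p.1, p.1⟫

theorem rf_apply (p v : V × ℝ) : rf p v = v - cc p v • p := by
  simp [rf, sAff, acoroot, cc, LinearMap.smulRight_apply]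
  congr 1; ring

theorem R_neg {Φ : Set V} (hΦ : IsRootSystem Φ) {p : V × ℝ} (hp : p ∈ R Φ) : -p ∈ R Φ := by
  obtain ⟨h, n, hn⟩ := hp
  exact ⟨hΦ.neg_mem _ h, -n, by simp [hn]⟩

theorem inner_ne {Φ : Set V} (hΦ : IsRootSystem Φ) {p : V × ℝ} (hp : p ∈ R Φ) :
    ⟪p.1, p.1⟫ ≠ 0 := by
  have := hΦ.ne_zero _ hp.1
  simpa using this

theorem cc_self {Φ : Set V} (hΦ : IsRootSystem Φ) {p : V × ℝ} (hp : p ∈ R Φ) : cc p p = 2 := by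
  have := inner_ne hΦ hp
  unfold cc; field_simp

theorem rf_self {Φ : Set V} (hΦ : IsRootSystem Φ) {p : V × ℝ} (hp : p ∈ R Φ) : rf p p = -p := by
  rw [rf_apply, cc_self hΦ hp]; module

theorem cc_rf {Φ : Set V} (hΦ : IsRootSystem Φ) {p : V × ℝ} (hp : p ∈ R Φ) (v : V × ℝ) :
    cc p (rf p v) = - cc p v := by
  have := inner_ne hΦ hp
  rw [rf_apply]
  simp only [cc, Prod.fst_sub, Prod.smul_fst, inner_sub_right, inner_smul_right]
  field_simp
  ring

theorem rf_rf {Φ : Set V} (hΦ : IsRootSystem Φ) {p : V × ℝ} (hp : p ∈ R Φ) (v : V × ℝ) :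
    rf p (rf p v) = v := by
  rw [rf_apply p (rf p v), cc_rf hΦ hp, rf_apply]; module

theorem rf_mul {Φ : Set V} (hΦ : IsRootSystem Φ) {p : V × ℝ} (hp : p ∈ R Φ) :
    rf p * rf p = 1 := by
  ext1 <;> ext1 <;> simp [rf_rf hΦ hp]

theorem rf_neg (p : V × ℝ) : rf (-p) = rf p := by
  apply LinearMap.ext; intro v
  rw [rf_apply, rf_apply]
  simp [cc, neg_div]

/-- good elements: preserve roots, form, delta -/
structure Good (Φ : Set V) (x : Module.End ℝ (V × ℝ)) : Prop where
  root : ∀ p ∈ R Φ, x p ∈ R Φ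
  form : ∀ u v, ⟪(x u).1, (x v).1⟫ = ⟪u.1, v.1⟫
  del : ∀ c : ℝ, x (0, c) = (0, c)

theorem Good.mul {Φ : Set V} {x y : Module.End ℝ (V × ℝ)} (hx : Good Φ x) (hy : Good Φ y) :
    Good Φ (x * y) :=
  ⟨fun p hp => hx.root _ (hy.root _ hp), fun u v => by simp [hx.form, hy.form],
   fun c => by simp [hx.del, hy.del]⟩

theorem Good.one {Φ : Set V} : Good Φ (1 : Module.End ℝ (V × ℝ)) :=
  ⟨fun p hp => hp, fun u v => rfl, fun c => rfl⟩

theorem good_rf {Φ : Set V} (hΦ : IsRootSystem Φ) {p : V × ℝ} (hp : p ∈ R Φ) :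
    Good Φ (rf p) := by
  refine ⟨fun q hq => ?_, fun u v => ?_, fun c => ?_⟩
  · have e : cc p q = pairing q.1 p.1 := by
      unfold cc pairing; rw [real_inner_comm]
    rw [rf_apply, e]
    refine ⟨hΦ.reflect_mem _ hp.1 _ hq.1, ?_⟩
    obtain ⟨k, hk⟩ := hΦ.crystal _ hp.1 _ hq.1
    obtain ⟨m, hm⟩ := hp.2
    obtain ⟨n, hn⟩ := hq.2
    exact ⟨n - k * m, by simp [hk, hm, hn]⟩
  · have := inner_ne hΦ hp
    simp only [rf_apply, cc, Prod.fst_sub, Prod.smul_fst, inner_sub_right, inner_smul_right,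
      inner_sub_left, inner_smul_left, real_inner_comm u.1 p.1]
    simp
    simp only [real_inner_comm p.1 u.1]
    have h2 : ⟪p.1, p.1⟫ = ‖p.1‖ ^ 2 := real_inner_self_eq_norm_sq _
    rw [h2] at *
    have h3 : ‖p.1‖ ≠ 0 := by intro h; simp [h] at this
    field_simp
    ring
  · rw [rf_apply]; simp [cc]

theorem good_of_mem {Φ : Set V} (hΦ : IsRootSystem Φ) {x : Module.End ℝ (V × ℝ)}
    (hx : x ∈ Submonoid.closure (AffRefls Φ)) : Good Φ x := by
  induction hx using Submonoid.closure_induction with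
  | mem x h =>
    obtain ⟨β, hβ, n, rfl⟩ := h
    exact good_rf hΦ (p := (β, (n : ℝ))) ⟨hβ, n, rfl⟩
  | one => exact Good.one
  | mul x y _ _ hx hy => exact hx.mul hy

theorem Good.conj {Φ : Set V} {x : Module.End ℝ (V × ℝ)} (hx : Good Φ x) (p : V × ℝ) :
    x * rf p = rf (x p) * x := by
  apply LinearMap.ext; intro v
  simp only [Module.End.mul_apply, rf_apply, map_sub, map_smul]
  simp only [cc, hx.form]

/-- positivity functional -/
structure PosF (Φ : Set V) (P : Set (V × ℝ)) (F : (V × ℝ) →ₗ[ℝ] ℝ) : Prop where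
  iff : ∀ p, p ∈ P ↔ p ∈ R Φ ∧ 0 < F p
  ne : ∀ p ∈ R Φ, F p ≠ 0

theorem exists_f {Φ : Set V} {Δ : Finset V} (hΔ : IsBase Φ Δ) (e : V → ℝ) :
    ∃ f : V →ₗ[ℝ] ℝ, ∀ b ∈ Δ, f b = e b := by
  let B := Module.Basis.extend hΔ.indep.linearIndepOn_id
  refine ⟨B.constr ℝ (fun i => e i.1), fun b hb => ?_⟩
  have hb' : b ∈ hΔ.indep.linearIndepOn_id.extend (Set.subset_univ _) :=
    hΔ.indep.linearIndepOn_id.subset_extend _ ⟨⟨b, hb⟩, rfl⟩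
  have h := B.constr_basis ℝ (fun i => e i.1) ⟨b, hb'⟩
  have h2 : B ⟨b, hb'⟩ = b := by simp [B]
  rw [h2] at h
  exact h

theorem f_sum {Δ : Finset V} {f : V →ₗ[ℝ] ℝ} (hf : ∀ b ∈ Δ, f b = 1) (c : V → ℕ) :
    f (∑ b ∈ Δ, (c b : ℝ) • b) = ∑ b ∈ Δ, (c b : ℝ) := by
  rw [map_sum]
  exact Finset.sum_congr rfl fun b hb => by simp [hf b hb]

theorem f_nonneg {Δ : Finset V} {f : V →ₗ[ℝ] ℝ} (hf : ∀ b ∈ Δ, f b = 1) {v : V}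
    (hv : ∃ c : V → ℕ, v = ∑ b ∈ Δ, (c b : ℝ) • b) : 0 ≤ f v ∧ (f v = 0 → v = 0) := by
  obtain ⟨c, rfl⟩ := hv
  rw [f_sum hf]
  refine ⟨Finset.sum_nonneg fun b _ => by positivity, fun h => ?_⟩
  rw [Finset.sum_eq_zero_iff_of_nonneg (fun b _ => by positivity)] at h
  exact Finset.sum_eq_zero fun b hb => by simp [h b hb]

theorem f_ne {Φ : Set V} (hΦ : IsRootSystem Φ) {Δ : Finset V} (hΔ : IsBase Φ Δ)
    {f : V →ₗ[ℝ] ℝ} (hf : ∀ b ∈ Δ, f b = 1) {β : V} (hβ : β ∈ Φ) : f β ≠ 0 := by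
  intro h
  rcases hΔ.pos_or_neg β hβ with h' | h'
  · exact hΦ.ne_zero _ hβ ((f_nonneg hf h').2 h)
  · exact hΦ.ne_zero _ hβ (neg_eq_zero.1 ((f_nonneg hf h').2 (by simp [h])))

theorem posRoots_iff {Φ : Set V} (hΦ : IsRootSystem Φ) {Δ : Finset V} (hΔ : IsBase Φ Δ)
    {f : V →ₗ[ℝ] ℝ} (hf : ∀ b ∈ Δ, f b = 1) {β : V} (hβ : β ∈ Φ) :
    β ∈ PosRoots Φ Δ ↔ 0 < f β := by
  constructor
  · rintro ⟨_, h⟩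
    exact lt_of_le_of_ne (f_nonneg hf h).1 (f_ne hΦ hΔ hf hβ).symm
  · intro h
    rcases hΔ.pos_or_neg β hβ with h' | h'
    · exact ⟨hβ, h'⟩
    · have := (f_nonneg hf h').1
      simp at this; linarith

theorem exists_F {Φ : Set V} (hΦ : IsRootSystem Φ) {Δ : Finset V} (hΔ : IsBase Φ Δ) :
    ∃ F, PosF Φ (PosAffRoots Φ Δ) F := by
  obtain ⟨f, hf⟩ := exists_f hΔ (fun _ => 1)
  obtain ⟨M, hM⟩ := (hΦ.finite.image (fun β => |f β|)).bddAbove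
  have hM' : ∀ β ∈ Φ, |f β| ≤ M := fun β hβ => hM ⟨β, hβ, rfl⟩
  refine ⟨(M + 1) • LinearMap.snd ℝ V ℝ + f ∘ₗ LinearMap.fst ℝ V ℝ, ?_, ?_⟩
  · rintro ⟨β, r⟩
    simp only [PosAffRoots, R, Set.mem_setOf_eq, LinearMap.add_apply, LinearMap.smul_apply,
      LinearMap.snd_apply, LinearMap.comp_apply, LinearMap.fst_apply, smul_eq_mul]
    constructor
    · rintro ⟨hβ, ⟨n, rfl⟩, h⟩
      refine ⟨⟨hβ, n, rfl⟩, ?_⟩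
      have := abs_le.1 (hM' β hβ)
      rcases h with h | ⟨h, h'⟩
      · have hn0 : 0 < n := by exact_mod_cast h
        have hn : (1 : ℝ) ≤ n := by exact_mod_cast Int.add_one_le_iff.2 hn0
        nlinarith
      · rw [posRoots_iff hΦ hΔ hf hβ] at h'
        rw [h]; linarith
    · rintro ⟨⟨hβ, n, rfl⟩, h⟩
      refine ⟨hβ, ⟨n, rfl⟩, ?_⟩
      have := abs_le.1 (hM' β hβ)
      rw [posRoots_iff hΦ hΔ hf hβ]
      rcases lt_trichotomy n 0 with hn | rfl | hn
      · have hn : (n : ℝ) ≤ -1 := by exact_mod_cast Int.le_sub_one_iff.2 hn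
        nlinarith
      · right; simpa using h
      · left; exact_mod_cast hn
  · rintro ⟨β, r⟩ ⟨hβ, n, hn⟩
    simp only at hβ hn
    subst hn
    simp only [LinearMap.add_apply, LinearMap.smul_apply,
      LinearMap.snd_apply, LinearMap.comp_apply, LinearMap.fst_apply, smul_eq_mul]
    have := abs_le.1 (hM' β hβ)
    have h0 := f_ne hΦ hΔ hf hβ
    rcases lt_trichotomy n 0 with hn | rfl | hn
    · have hn : (n : ℝ) ≤ -1 := by exact_mod_cast Int.le_sub_one_iff.2 hn
      apply ne_of_lt; nlinarith
    · simpa using h0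
    · have hn : (1 : ℝ) ≤ n := by exact_mod_cast Int.add_one_le_iff.2 hn
      apply ne_of_gt; nlinarith

theorem simple_mem {Φ : Set V} (hΦ : IsRootSystem Φ) {Δ : Finset V} (hΔ : IsBase Φ Δ)
    {θ : V} (hθ : IsHighestRoot Φ Δ θ) {a : V × ℝ} (ha : a ∈ SimpleAffRoots Δ θ) :
    a ∈ PosAffRoots Φ Δ := by
  rcases ha with ⟨b, hb, rfl⟩ | ha
  · refine ⟨hΔ.subset hb, ⟨0, by simp⟩, Or.inr ⟨rfl, hΔ.subset hb, fun v => if v = b then 1 else 0, ?_⟩⟩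
    have hb' : b ∈ Δ := hb
    simp [hb']
  · rw [Set.mem_singleton_iff] at ha
    subst ha
    exact ⟨hΦ.neg_mem _ hθ.1, ⟨1, by simp⟩, Or.inl (by simp)⟩

theorem simple_perm {Φ : Set V} (hΦ : IsRootSystem Φ) {Δ : Finset V} (hΔ : IsBase Φ Δ)
    {θ : V} (hθ : IsHighestRoot Φ Δ θ) {a : V × ℝ} (ha : a ∈ SimpleAffRoots Δ θ)
    {q : V × ℝ} (hq : q ∈ PosAffRoots Φ Δ) (hqa : q ≠ a) : rf a q ∈ PosAffRoots Φ Δ := by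
  obtain ⟨f, hf⟩ := exists_f hΔ (fun _ => 1)
  have haP := simple_mem hΦ hΔ hθ ha
  have hroot := (good_rf hΦ (p := a) ⟨haP.1, haP.2.1⟩).root q ⟨hq.1, hq.2.1⟩
  refine ⟨hroot.1, hroot.2, ?_⟩
  have hf0 := f_ne hΦ hΔ hf hroot.1
  rw [posRoots_iff hΦ hΔ hf hroot.1]
  obtain ⟨β, r⟩ := q
  obtain ⟨hβ, ⟨n, hn⟩, hpos⟩ := hq
  rw [posRoots_iff hΦ hΔ hf hβ] at hpos
  simp only at hβ hn hpos
  subst hn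
  rcases ha with ⟨b, hb, rfl⟩ | ha
  · rw [rf_apply] at *
    have hb' : b ∈ Δ := hb
    simp only [Prod.snd_sub, Prod.smul_snd, smul_zero, sub_zero, Prod.fst_sub, Prod.smul_fst] at *
    rcases hpos with h | ⟨h, h'⟩
    · left; exact h
    · right
      refine ⟨h, ?_⟩
      by_contra hneg
      generalize cc ((b, 0) : V × ℝ) (β, (n : ℝ)) = k at *
      obtain ⟨_, c, hc⟩ := (posRoots_iff hΦ hΔ hf hβ).2 h'
      obtain ⟨g, hg⟩ := exists_f hΔ (fun v => if v = b then 0 else 1)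
      have hgs : ∀ c : V → ℕ, g (∑ b ∈ Δ, (c b : ℝ) • b) = ∑ v ∈ Δ, if v = b then 0 else (c v : ℝ) := by
        intro c
        rw [map_sum]
        exact Finset.sum_congr rfl fun v hv => by
          rw [map_smul, hg v hv]
          by_cases h : v = b <;> simp [h]
      have hgb : g b = 0 := by simpa using hg b hb'
      have hnn : ∀ c : V → ℕ, ∀ v ∈ Δ, (0 : ℝ) ≤ if v = b then 0 else (c v : ℝ) := by
        intro c v _; split_ifs <;> positivity
      rcases hΔ.pos_or_neg _ hroot.1 with hd | ⟨d, hd⟩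
      · exact hneg (lt_of_le_of_ne (f_nonneg hf hd).1 hf0.symm)
      · have e1 : g β = ∑ v ∈ Δ, if v = b then 0 else (c v : ℝ) := by
          rw [← hgs, ← hc]
        have e2 : g (-(β - k • b)) = ∑ v ∈ Δ, if v = b then 0 else (d v : ℝ) := by
          rw [← hgs, ← hd]; simp
        have e3 : g (-(β - k • b)) = - g β := by simp [hgb]
        have p1 := Finset.sum_nonneg (hnn c)
        have p2 := Finset.sum_nonneg (hnn d)
        have z : (∑ v ∈ Δ, if v = b then 0 else (c v : ℝ)) = 0 := by linarith
        rw [Finset.sum_eq_zero_iff_of_nonneg (hnn c)] at z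
        have hβb : β = (c b : ℝ) • b := by
          rw [hc]
          apply Finset.sum_eq_single_of_mem b hb'
          intro v hv hvb
          have := z v hv
          simp [hvb] at this
          simp [this]
        have hr := hΦ.reduced b (hΔ.subset hb) (c b) (hβb ▸ hβ)
        have hc0 : (0 : ℝ) ≤ c b := by positivity
        rcases hr with hr | hr
        · apply hqa
          rw [hr, one_smul] at hβb
          rw [hβb, h]
        · linarith
  · rw [Set.mem_singleton_iff] at ha
    subst ha
    obtain ⟨k, hk⟩ := hΦ.crystal _ (hΦ.neg_mem _ hθ.1) _ hβ
    have e : cc ((-θ, 1) : V × ℝ) (β, (n : ℝ)) = k := by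
      rw [← hk]; unfold cc pairing; rw [real_inner_comm]
    have er : rf ((-θ, 1) : V × ℝ) (β, (n : ℝ)) = (β - (k : ℝ) • (-θ), (n : ℝ) - k) := by
      rw [rf_apply, e]; ext <;> simp
    rw [er] at hroot hf0 ⊢
    clear er e
    have h1 := f_nonneg hf (hθ.2 _ (hΦ.neg_mem _ hβ))
    have h2 := (f_nonneg hf (hθ.2 _ hroot.1)).1
    have h3 := (f_nonneg hf (hθ.2 _ (hΦ.neg_mem _ hθ.1))).1
    have h4 := f_ne hΦ hΔ hf hθ.1
    have h5 := f_ne hΦ hΔ hf hβ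
    simp only [map_sub, map_neg, map_smul, smul_eq_mul] at *
    have hθ0 : 0 < f θ := lt_of_le_of_ne (by linarith) h4.symm
    have hk2 : k ≤ 2 := by
      by_contra hh
      have : (3 : ℝ) ≤ k := by exact_mod_cast (by omega : (3:ℤ) ≤ k)
      nlinarith
    have hn0 : 0 ≤ n := by
      rcases hpos with h | h
      · exact_mod_cast h.le
      · exact_mod_cast h.1.ge
    rcases lt_or_ge 0 (n - k) with hnk | hnk
    · left; exact_mod_cast hnk
    · right
      have hn1 : 1 ≤ k → 1 ≤ n := by
        intro h
        have hk1 : (1 : ℝ) ≤ k := by exact_mod_cast h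
        have : f β ≤ 0 := by nlinarith
        rcases hpos with h | h
        · have : 0 < n := by exact_mod_cast h
          omega
        · linarith [h.2]
      have hn2 : k = 2 → n ≠ 1 := by
        rintro rfl rfl
        apply hqa
        have : f β = - f θ := by push_cast at h2; linarith
        have h6 := h1.2 (by linarith)
        have : β = -θ := by
          rw [sub_neg_eq_add] at h6
          exact (eq_neg_of_add_eq_zero_right h6)
        simp [this]
      have hnk' : n = k := by omega
      subst hnk'
      refine ⟨by simp, ?_⟩
      have hne := hf0
      rcases (by omega : n = 0 ∨ n = 1 ∨ n = 2) with rfl | rfl | rfl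
      · simp at hpos ⊢; exact hpos
      · push_cast at *
        exact lt_of_le_of_ne (by linarith [h1.1]) hne.symm
      · push_cast at *
        linarith [h1.1]

section order
variable {Φ : Set V} {Δ : Finset V} {F : (V × ℝ) →ₗ[ℝ] ℝ}

theorem fin_N {P : Set (V × ℝ)} (hΦ : IsRootSystem Φ) {w : Module.End ℝ (V × ℝ)}
    (hw : Good Φ w) : {p | p ∈ PosAffRoots Φ Δ ∧ -(w p) ∈ PosAffRoots Φ Δ}.Finite := by
  have hfin : (⋃ β ∈ Φ, (fun n : ℤ => ((β, (n : ℝ)) : V × ℝ)) ''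
      (Set.Icc 0 ⌈-(w (β, 0)).2⌉)).Finite :=
    hΦ.finite.biUnion fun β _ => (Set.finite_Icc _ _).image _
  refine hfin.subset ?_
  rintro ⟨β, r⟩ ⟨⟨hβ, ⟨n, hn⟩, hp⟩, ⟨-, -, hm⟩⟩
  simp only at hβ hn hp
  subst hn
  simp only [Set.mem_iUnion]
  refine ⟨β, hβ, n, ⟨?_, ?_⟩, rfl⟩
  · rcases hp with h | h
    · exact_mod_cast h.le
    · exact_mod_cast h.1.ge
  · have e : w (β, (n : ℝ)) = w (β, 0) + (0, (n : ℝ)) := by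
      rw [← hw.del, ← map_add]; simp
    rw [e] at hm
    have : 0 ≤ (-(w (β, 0) + (0, (n : ℝ)))).2 := by
      rcases hm with h | h
      · exact h.le
      · exact h.1.ge
    simp at this
    have h2 := Int.le_ceil (-(w (β, 0)).2)
    have : (n : ℝ) ≤ (⌈-(w (β, 0)).2⌉ : ℝ) := by linarith
    exact_mod_cast this

theorem length_lt (hΦ : IsRootSystem Φ) (hF : PosF Φ (PosAffRoots Φ Δ) F)
    {w : Module.End ℝ (V × ℝ)} (hw : Good Φ w) {p : V × ℝ} (hp : p ∈ R Φ) (hp0 : 0 < F p)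
    (hwp : 0 < F (w p)) : affLength Φ Δ w < affLength Φ Δ (w * rf p) := by
  have ht := good_rf hΦ hp
  have hN : ∀ x : Module.End ℝ (V × ℝ), Good Φ x →
      {p | p ∈ PosAffRoots Φ Δ ∧ -(x p) ∈ PosAffRoots Φ Δ} =
      {p | p ∈ R Φ ∧ 0 < F p ∧ F (x p) < 0} := by
    intro x hx
    ext q
    simp only [Set.mem_setOf_eq, hF.iff, map_neg]
    constructor
    · rintro ⟨⟨a, b⟩, c, d⟩; exact ⟨a, b, by linarith⟩
    · rintro ⟨a, b, c⟩; exact ⟨⟨a, b⟩, R_neg hΦ (hx.root _ a), by linarith⟩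
  have hf1 := fin_N (P := ∅) (Δ := Δ) hΦ hw
  have hf2 := fin_N (P := ∅) (Δ := Δ) hΦ (hw.mul ht)
  unfold affLength
  rw [hN _ hw] at *
  rw [hN _ (hw.mul ht)] at *
  let g : V × ℝ → V × ℝ := fun q => if 0 < F (rf p q) then rf p q else q
  have hFt : ∀ q, F (rf p q) = F q - cc p q * F p := fun q => by simp [rf_apply]
  have hinj : Set.InjOn g {p | p ∈ R Φ ∧ 0 < F p ∧ F (w p) < 0} := by
    rintro q ⟨_, hq, _⟩ q' ⟨_, hq', _⟩ h
    simp only [g] at h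
    split_ifs at h with h1 h2 h2
    · rw [← rf_rf hΦ hp q, h, rf_rf hΦ hp]
    · rw [← h, rf_rf hΦ hp] at h2; exact absurd hq h2
    · rw [h, rf_rf hΦ hp] at h1; exact absurd hq' h1
    · exact h
  rw [← Set.ncard_image_of_injOn hinj]
  apply Set.ncard_lt_ncard _ hf2
  refine ⟨?_, ?_⟩
  · rintro _ ⟨q, ⟨hq, hq0, hwq⟩, rfl⟩
    simp only [g]
    split_ifs with h
    · exact ⟨ht.root _ hq, h, by simpa [rf_rf hΦ hp] using hwq⟩
    · refine ⟨hq, hq0, ?_⟩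
      rw [hFt] at h
      have hc : 0 < cc p q := by
        by_contra hc
        push Not at hc
        nlinarith
      simp only [Module.End.mul_apply, rf_apply, map_sub, map_smul, smul_eq_mul]
      nlinarith
  · intro hsub
    have hpm : p ∈ {q | q ∈ R Φ ∧ 0 < F q ∧ F ((w * rf p) q) < 0} :=
      ⟨hp, hp0, by simp [rf_self hΦ hp, hwp]⟩
    obtain ⟨q, ⟨hq, hq0, hwq⟩, hg⟩ := hsub hpm
    simp only [g] at hg
    split_ifs at hg with h
    · have : q = -p := by rw [← rf_rf hΦ hp q, hg, rf_self hΦ hp]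
      rw [this] at hq0; simp at hq0; linarith
    · rw [hg] at hwq; linarith

/-- edge -/
def E (Φ : Set V) (F : (V × ℝ) →ₗ[ℝ] ℝ) (x y : Module.End ℝ (V × ℝ)) : Prop :=
  Good Φ x ∧ ∃ p ∈ R Φ, 0 < F p ∧ 0 < F (x p) ∧ y = x * rf p

theorem E.good (hΦ : IsRootSystem Φ) {x y : Module.End ℝ (V × ℝ)} (h : E Φ F x y) :
    Good Φ y := by
  obtain ⟨h, p, hp, _, _, rfl⟩ := h
  exact h.mul (good_rf hΦ hp)

theorem edge_iff (hΦ : IsRootSystem Φ) (hF : PosF Φ (PosAffRoots Φ Δ) F)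
    {x y : Module.End ℝ (V × ℝ)} (hx : Good Φ x) :
    ((∃ t ∈ AffRefls Φ, y = x * t) ∧ affLength Φ Δ x < affLength Φ Δ y) ↔ E Φ F x y := by
  constructor
  · rintro ⟨⟨_, ⟨β, hβ, n, rfl⟩, rfl⟩, hl⟩
    have key : ∀ p ∈ R Φ, 0 < F p → affLength Φ Δ x < affLength Φ Δ (x * rf p) →
        E Φ F x (x * rf p) := by
      intro p hp hp0 hl
      refine ⟨hx, p, hp, hp0, ?_, rfl⟩
      by_contra hneg
      have h1 := hF.ne _ (hx.root _ hp)
      have h2 : F (x p) < 0 := lt_of_le_of_ne (not_lt.1 hneg) h1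
      have := length_lt (w := x * rf p) hΦ hF (hx.mul (good_rf hΦ hp)) hp hp0
        (by simpa [rf_self hΦ hp] using h2)
      rw [mul_assoc, rf_mul hΦ hp, mul_one] at this
      omega
    have hp : ((β, (n : ℝ)) : V × ℝ) ∈ R Φ := ⟨hβ, n, rfl⟩
    have hl : affLength Φ Δ x < affLength Φ Δ (x * rf (β, (n : ℝ))) := hl
    change E Φ F x (x * rf (β, (n : ℝ)))
    rcases lt_or_gt_of_ne (hF.ne _ hp) with h | h
    · rw [← rf_neg] at hl ⊢
      exact key _ (R_neg hΦ hp) (by rw [map_neg]; linarith) hl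
    · exact key _ hp h hl
  · rintro ⟨_, p, hp, hp0, hxp, rfl⟩
    obtain ⟨n, hn⟩ := hp.2
    exact ⟨⟨_, ⟨p.1, hp.1, n, rfl⟩, by rw [rf, hn]⟩, length_lt hΦ hF hx hp hp0 hxp⟩

theorem le_iff (hΦ : IsRootSystem Φ) (hF : PosF Φ (PosAffRoots Φ Δ) F)
    {x y : Module.End ℝ (V × ℝ)} (hx : Good Φ x) :
    bruhatLE Φ Δ x y ↔ Relation.ReflTransGen (E Φ F) x y := by
  constructor
  · intro h
    suffices Relation.ReflTransGen (E Φ F) x y ∧ Good Φ y from this.1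
    induction h with
    | refl => exact ⟨.refl, hx⟩
    | tail _ h ih =>
      have := (edge_iff hΦ hF ih.2).1 h
      exact ⟨ih.1.tail this, this.good hΦ⟩
  · intro h
    exact Relation.ReflTransGen.mono (fun u v h => (edge_iff hΦ hF h.1).2 h) _ _ h

theorem length_le_of {x y : Module.End ℝ (V × ℝ)} (h : bruhatLE Φ Δ x y) :
    affLength Φ Δ x ≤ affLength Φ Δ y := by
  induction h with
  | refl => exact le_rfl
  | tail _ h ih => exact ih.trans h.2.le

/-- abstract collapse lemma -/
theorem collapse {A : Type*} {r : A → A → Prop} (m : A → A) (hm : ∀ x, m (m x) = x)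
    (h : ∀ x y, r x y → y = m x ∨ r (m x) (m y)) {u w : A} (huw : Relation.ReflTransGen r u w) :
    (Relation.ReflTransGen r (m u) w ∨ Relation.ReflTransGen r (m u) (m w)) ∧
    (Relation.ReflTransGen r u (m w) ∨ Relation.ReflTransGen r (m u) (m w)) := by
  induction huw with
  | refl => exact ⟨.inr .refl, .inr .refl⟩
  | @tail b c hub hbc ih =>
    constructor
    · rcases ih.1 with i | i
      · exact .inl (i.tail hbc)
      · rcases h _ _ hbc with rfl | h
        · exact .inl i
        · exact .inr (i.tail h)
    · rcases h _ _ hbc with rfl | h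
      · left; rw [hm]; exact hub
      · rcases ih.2 with i | i
        · exact .inl (i.tail h)
        · exact .inr (i.tail h)

end order

end Aff

open Aff in
theorem stmt8 {V : Type*} [NormedAddCommGroup V] [InnerProductSpace ℝ V]
    (Φ : Set V) (hΦ : IsRootSystem Φ) (hirr : IsIrreducibleRS Φ)
    (Δ : Finset V) (hΔ : IsBase Φ Δ) (θ : V) (hθ : IsHighestRoot Φ Δ θ)
    (a : V × ℝ) (ha : a ∈ SimpleAffRoots Δ θ)
    (σ τ : Module.End ℝ (V × ℝ))
    (hσW : σ ∈ Submonoid.closure (AffRefls Φ)) (hτW : τ ∈ Submonoid.closure (AffRefls Φ))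
    (hσinv : σ * σ = 1) (hτinv : τ * τ = 1)
    (hlt : bruhatLT Φ Δ σ τ)
    (h1 : bruhatLT Φ Δ σ (rsCirc (sAff a.1 a.2) σ))
    (h2 : bruhatLT Φ Δ (rsCirc (sAff a.1 a.2) τ) τ) :
    bruhatLE Φ Δ (rsCirc (sAff a.1 a.2) σ) τ ∧ bruhatLE Φ Δ σ (rsCirc (sAff a.1 a.2) τ) := by
  obtain ⟨F, hF⟩ := exists_F hΦ hΔ
  have hσ := good_of_mem hΦ hσW
  have hτ := good_of_mem hΦ hτW
  obtain ⟨haR, ha0⟩ := (hF.iff a).1 (simple_mem hΦ hΔ hθ ha)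
  have hperm : ∀ q ∈ R Φ, 0 < F q → q ≠ a → 0 < F (rf a q) := fun q hq hq0 hqa =>
    ((hF.iff _).1 (simple_perm hΦ hΔ hθ ha ((hF.iff q).2 ⟨hq, hq0⟩) hqa)).2
  change bruhatLT Φ Δ σ (rsCirc (rf a) σ) at h1
  change bruhatLT Φ Δ (rsCirc (rf a) τ) τ at h2
  change bruhatLE Φ Δ (rsCirc (rf a) σ) τ ∧ bruhatLE Φ Δ σ (rsCirc (rf a) τ)
  have hs := good_rf hΦ haR
  have hss := rf_mul hΦ haR
  set s := rf a with hsdef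
  have hsa : s a = -a := rf_self hΦ haR
  have hsv : ∀ v, s (s v) = v := rf_rf hΦ haR
  -- edge criteria
  have edgeR : ∀ x, Good Φ x → 0 < F (x a) → E Φ F x (x * s) := fun x hx h =>
    ⟨hx, a, haR, ha0, h, rfl⟩
  have edgeR' : ∀ x, Good Φ x → F (x a) < 0 → E Φ F (x * s) x := fun x hx h =>
    ⟨hx.mul hs, a, haR, ha0, by simpa [hsa] using h, by rw [mul_assoc, hss, mul_one]⟩
  have edgeL : ∀ x, Good Φ x → x * x = 1 → 0 < F (x a) → E Φ F x (s * x) := by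
    intro x hx hxx h
    have e : x (x a) = a := by rw [← Module.End.mul_apply, hxx]; rfl
    exact ⟨hx, x a, hx.root _ haR, h, by rwa [e], by rw [hx.conj, e]⟩
  have edgeL' : ∀ x, Good Φ x → x * x = 1 → F (x a) < 0 → E Φ F (s * x) x := by
    intro x hx hxx h
    have e : x (x a) = a := by rw [← Module.End.mul_apply, hxx]; rfl
    refine ⟨hs.mul hx, -(x a), R_neg hΦ (hx.root _ haR), by simpa using h, ?_, ?_⟩
    · simpa [e, hsa] using ha0
    · rw [rf_neg, mul_assoc, hx.conj, e, ← mul_assoc, hss, one_mul]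
  have comm_of : ∀ x, Good Φ x → (x a = a ∨ x a = -a) → s * x = x * s := by
    intro x hx h
    have hc := hx.conj a
    rcases h with h | h
    · rw [h] at hc; exact hc.symm
    · rw [h, rf_neg] at hc; exact hc.symm
  have elen : ∀ x y, E Φ F x y → affLength Φ Δ x < affLength Φ Δ y := fun x y h =>
    ((edge_iff hΦ hF h.1).2 h).2
  -- signs
  have negcase : ∀ x, Good Φ x → s * x ≠ x * s → F (x a) < 0 → F ((s * x) a) < 0 := by
    intro x hx hc h
    have := hperm (-(x a)) (R_neg hΦ (hx.root _ haR)) (by simpa using h)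
      (fun h' => hc (comm_of x hx (.inr (neg_eq_iff_eq_neg.1 h'))))
    simpa using this
  have poscase : ∀ x, Good Φ x → s * x ≠ x * s → 0 < F (x a) → 0 < F ((s * x) a) := by
    intro x hx hc h
    exact hperm (x a) (hx.root _ haR) h (fun h' => hc (comm_of x hx (.inl h')))
  have hσa : 0 < F (σ a) := by
    by_contra hneg
    have hn : F (σ a) < 0 := lt_of_le_of_ne (not_lt.1 hneg) (hF.ne _ (hσ.root _ haR))
    have l0 := length_le_of h1.1
    have l1 := elen _ _ (edgeL' σ hσ hσinv hn)
    unfold rsCirc at l0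
    split_ifs at l0 with hc
    · omega
    · have l2 := elen _ _ (edgeR' (s * σ) (hs.mul hσ) (negcase σ hσ hc hn))
      omega
  have hτa : F (τ a) < 0 := by
    by_contra hneg
    have hn : 0 < F (τ a) := lt_of_le_of_ne (not_lt.1 hneg) (hF.ne _ (hτ.root _ haR)).symm
    have l0 := length_le_of h2.1
    have l1 := elen _ _ (edgeL τ hτ hτinv hn)
    unfold rsCirc at l0
    split_ifs at l0 with hc
    · omega
    · have l2 := elen _ _ (edgeR (s * τ) (hs.mul hτ) (poscase τ hτ hc hn))
      omega
  -- collapse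
  have colL := fun u w (h : Relation.ReflTransGen (E Φ F) u w) =>
    collapse (r := E Φ F) (fun x => s * x) (fun x => by rw [← mul_assoc, hss, one_mul]) (by
      rintro x y ⟨hx, p, hp, hp0, hxp, rfl⟩
      by_cases h : x p = a
      · left; rw [hx.conj, h]
      · right
        exact ⟨hs.mul hx, p, hp, hp0, hperm _ (hx.root _ hp) hxp h, by rw [mul_assoc]⟩) h
  have colR := fun u w (h : Relation.ReflTransGen (E Φ F) u w) =>
    collapse (r := E Φ F) (fun x => x * s) (fun x => by rw [mul_assoc, hss, mul_one]) (by
      rintro x y ⟨hx, p, hp, hp0, hxp, rfl⟩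
      by_cases h : p = a
      · left; rw [h]
      · right
        refine ⟨hx.mul hs, s p, hs.root _ hp, hperm _ hp hp0 h, by simpa [hsv] using hxp, ?_⟩
        rw [mul_assoc, mul_assoc, hs.conj, hsv]) h
  have hle := (le_iff hΦ hF hσ).1 hlt.1
  have A1 : Relation.ReflTransGen (E Φ F) (s * σ) τ := by
    rcases (colL _ _ hle).1 with h | h
    · exact h
    · exact h.tail (edgeL' τ hτ hτinv hτa)
  have A2 : Relation.ReflTransGen (E Φ F) σ (s * τ) := by
    rcases (colL _ _ hle).2 with h | h
    · exact h
    · exact .head (edgeL σ hσ hσinv hσa) h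
  constructor
  · unfold rsCirc
    split_ifs with hc
    · exact (le_iff hΦ hF (hs.mul hσ)).2 A1
    · refine (le_iff hΦ hF ((hs.mul hσ).mul hs)).2 ?_
      rcases (colR _ _ A1).1 with h | h
      · exact h
      · exact h.tail (edgeR' τ hτ hτa)
  · refine (le_iff hΦ hF hσ).2 ?_
    unfold rsCirc
    split_ifs with hc
    · exact A2
    · rcases (colR _ _ A2).2 with h | h
      · exact h
      · exact .head (edgeR σ hσ hσa) h
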